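/- The map D ↦ μ_D is an affine bijection from the set Lsc(W(X,G)) of lower semi-continuous states on W(X,G) to the set Pr_G(X) of G-invariant regular premeasures on the algebra generated by open sets of X. In particular, it restricts to an affine bijection between the lower semi-continuous states D with D([1_X]) = 1 and the G-invariant regular Borel probability measures M_G(X). -/

import Mathlib

open scoped Pointwise NNReal ENNReal

variable {X : Type*} [TopologicalSpace X] {G : Type*} [Group G] [MulAction G X]

/-- The open support of a continuous `ℝ≥0`-valued function. -/
def osupp (f : C(X, ℝ≥0)) : Set X := {x | f x ≠ 0}

/-- Dynamical subequivalence `A ≼ B` for two finite tuples (lists) of subsets of `X`. -/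
def SetSubeq (G : Type*) [Group G] [MulAction G X] (A B : List (Set X)) : Prop :=
  ∀ F : Fin A.length → Set X,
    (∀ i, IsClosed (F i) ∧ F i ⊆ A.get i) →
    ∃ (J : Fin A.length → ℕ)
      (U : (i : Fin A.length) → Fin (J i) → Set X)
      (s : (i : Fin A.length) → Fin (J i) → G)
      (k : (i : Fin A.length) → Fin (J i) → Fin B.length),
      (∀ i j, IsOpen (U i j)) ∧
      (∀ i, F i ⊆ ⋃ j, U i j) ∧
      (∀ i j, (s i j) • U i j ⊆ B.get (k i j)) ∧
      (∀ (p q : Σ i : Fin A.length, Fin (J i)), p ≠ q → k p.1 p.2 = k q.1 q.2 →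
        Disjoint ((s p.1 p.2) • U p.1 p.2) ((s q.1 q.2) • U q.1 q.2))

/-- Dynamical subequivalence `a ≼ b` for tuples of nonnegative continuous functions. -/
def DynSubeq (G : Type*) [Group G] [MulAction G X] (a b : List C(X, ℝ≥0)) : Prop :=
  SetSubeq G (a.map osupp) (b.map osupp)

/-- The entrywise cut-down `(f - ε)₊`. -/
noncomputable def cutFun (f : C(X, ℝ≥0)) (ε : ℝ≥0) : C(X, ℝ≥0) :=
  ⟨fun x => f x - ε, f.continuous.sub continuous_const⟩

noncomputable def cutList (a : List C(X, ℝ≥0)) (ε : ℝ≥0) : List C(X, ℝ≥0) := a.map (cutFun · ε)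

/-- Membership in the algebra of sets generated by the open sets of `X`. -/
def InAlg (X : Type*) [TopologicalSpace X] (s : Set X) : Prop :=
  s ∈ MeasureTheory.generateSetAlgebra {t : Set X | IsOpen t}

/-- A `G`-invariant regular premeasure on the algebra generated by the open sets. -/
structure InvRegPremeasure (X : Type*) [TopologicalSpace X] (G : Type*) [Group G]
    [MulAction G X] where
  m : Set X → ℝ≥0∞
  junk : ∀ s : Set X, ¬ InAlg X s → m s = 0
  empty' : m ∅ = 0
  countably_additive : ∀ A : ℕ → Set X, (∀ n, InAlg X (A n)) →
    Pairwise (Function.onFun Disjoint A) → InAlg X (⋃ n, A n) →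
    m (⋃ n, A n) = ∑' n, m (A n)
  invariant : ∀ (g : G) (s : Set X), InAlg X s → m (g • s) = m s
  inner_regular : ∀ s : Set X, InAlg X s →
    m s = ⨆ (F : Set X) (_ : IsCompact F ∧ F ⊆ s), m F
  outer_regular : ∀ s : Set X, InAlg X s →
    m s = ⨅ (O : Set X) (_ : IsOpen O ∧ s ⊆ O), m O

/-- A state on the generalized type semigroup `W(X, G)`, described at the level of
`K(X, G)`: a function on tuples which is monotone for `≼`, additive for concatenation,
and vanishes on the empty tuple. -/
structure DynState (X : Type*) [TopologicalSpace X] (G : Type*) [Group G]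
    [MulAction G X] where
  toFun : List C(X, ℝ≥0) → ℝ≥0∞
  mono : ∀ a b, DynSubeq G a b → toFun a ≤ toFun b
  additive : ∀ a b, toFun (a ++ b) = toFun a + toFun b
  zero' : toFun [] = 0

/-- Lower semicontinuity of a state. -/
def DynState.LSC (D : DynState X G) : Prop :=
  ∀ a, D.toFun a = ⨆ (ε : ℝ≥0) (_ : 0 < ε), D.toFun (cutList a ε)

section Auxiliary

open MeasureTheory Set

/-! ### Open supports and the algebra generated by the open sets -/

theorem isOpen_osupp (f : C(X, ℝ≥0)) : IsOpen (osupp f) :=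
  isOpen_ne.preimage f.continuous

theorem exists_osupp_eq [TopologicalSpace.MetrizableSpace X] {O : Set X} (hO : IsOpen O) :
    ∃ f : C(X, ℝ≥0), osupp f = O := by
  let := TopologicalSpace.metrizableSpaceMetric X
  rcases Oᶜ.eq_empty_or_nonempty with h | h
  · refine ⟨1, ?_⟩
    rw [compl_empty_iff.1 h]
    ext x
    simp [osupp]
  · refine ⟨⟨fun x => Metric.infNndist x Oᶜ, Metric.continuous_infNndist_pt _⟩, ?_⟩
    ext x
    have : x ∈ Oᶜ ↔ Metric.infDist x Oᶜ = 0 := hO.isClosed_compl.mem_iff_infDist_zero h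
    rw [← Metric.coe_infNndist, NNReal.coe_eq_zero] at this
    change Metric.infNndist x Oᶜ ≠ 0 ↔ x ∈ O
    rw [Ne, ← this, notMem_compl_iff]

theorem osupp_cutFun (f : C(X, ℝ≥0)) (ε : ℝ≥0) : osupp (cutFun f ε) = {x | ε < f x} := by
  ext x
  change f x - ε ≠ 0 ↔ ε < f x
  simp [tsub_eq_zero_iff_le]

theorem osupp_cutFun_anti (f : C(X, ℝ≥0)) : Antitone fun ε => osupp (cutFun f ε) := by
  intro ε δ h
  simp only [osupp_cutFun]
  exact fun x hx => lt_of_le_of_lt h hx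

theorem iUnion_osupp_cutFun (f : C(X, ℝ≥0)) :
    ⋃ n : ℕ, osupp (cutFun f (1 / ((n : ℝ≥0) + 1))) = osupp f := by
  ext x
  simp only [osupp_cutFun, mem_iUnion]
  change (∃ n : ℕ, 1 / ((n : ℝ≥0) + 1) < f x) ↔ f x ≠ 0
  refine ⟨fun ⟨n, hn⟩ => (lt_of_le_of_lt zero_le hn).ne', fun h => ?_⟩
  obtain ⟨n, hn⟩ := exists_nat_one_div_lt (NNReal.coe_pos.2 (pos_iff_ne_zero.2 h))
  exact ⟨n, by rw [← NNReal.coe_lt_coe]; push_cast; exact hn⟩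

theorem IsOpen.inAlg {O : Set X} (hO : IsOpen O) : InAlg X O :=
  self_subset_generateSetAlgebra hO

theorem IsClosed.inAlg {F : Set X} (hF : IsClosed F) : InAlg X F := by
  have := isSetAlgebra_generateSetAlgebra.compl_mem
    (self_subset_generateSetAlgebra (𝒜 := {t : Set X | IsOpen t}) hF.isOpen_compl)
  rwa [compl_compl] at this

theorem InAlg.measurableSet [MeasurableSpace X] [BorelSpace X] {s : Set X} (hs : InAlg X s) :
    MeasurableSet s := by
  induction hs with
  | base t ht => exact IsOpen.measurableSet ht
  | empty => exact MeasurableSet.empty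
  | compl t _ h => exact h.compl
  | union t u _ _ ht hu => exact ht.union hu

theorem InAlg.isGδ_and_compl [TopologicalSpace.MetrizableSpace X] {s : Set X} (hs : InAlg X s) :
    IsGδ s ∧ IsGδ sᶜ := by
  let := TopologicalSpace.metrizableSpaceMetric X
  induction hs with
  | base t ht => exact ⟨IsOpen.isGδ ht, (IsOpen.isClosed_compl ht).isGδ⟩
  | empty => simp
  | compl t _ h => exact ⟨h.2, by rw [compl_compl]; exact h.1⟩
  | union t u _ _ ht hu => exact ⟨ht.1.union hu.1, by rw [compl_union]; exact ht.2.inter hu.2⟩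

theorem InAlg.exists_iUnion_isClosed [TopologicalSpace.MetrizableSpace X] {s : Set X}
    (hs : InAlg X s) :
    ∃ F : ℕ → Set X, (∀ n, IsClosed (F n)) ∧ Monotone F ∧ ⋃ n, F n = s := by
  obtain ⟨U, hU, hsU⟩ := hs.isGδ_and_compl.2.eq_iInter_nat
  refine ⟨accumulate fun n => (U n)ᶜ, fun n => ?_, monotone_accumulate, ?_⟩
  · exact (finite_Iic n).isClosed_biUnion fun i _ => (hU i).isClosed_compl
  · rw [iUnion_accumulate, ← compl_iInter, ← hsU, compl_compl]

theorem InAlg.smul [ContinuousConstSMul G X] (g : G) {s : Set X} (hs : InAlg X s) :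
    InAlg X (g • s) := by
  induction hs with
  | base t ht => exact IsOpen.inAlg (IsOpen.smul ht g)
  | empty => rw [smul_set_empty]; exact generateSetAlgebra.empty
  | compl t _ h => rw [smul_set_compl]; exact generateSetAlgebra.compl _ h
  | union t u _ _ ht hu => rw [smul_set_union]; exact generateSetAlgebra.union _ _ ht hu

/-! ### From measures to premeasures and states -/

open Classical in
/-- The restriction of an invariant outer regular Borel measure to the algebra generated by
the open sets. -/
noncomputable def premeasureOfMeasure [CompactSpace X]
    [TopologicalSpace.MetrizableSpace X] [MeasurableSpace X] [BorelSpace X]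
    [ContinuousConstSMul G X] (μ : Measure X) [μ.OuterRegular]
    (hμ : ∀ (g : G) (s : Set X), MeasurableSet s → μ (g • s) = μ s) : InvRegPremeasure X G where
  m s := if InAlg X s then μ s else 0
  junk s hs := if_neg hs
  empty' := by simp
  countably_additive A hA hd hU := by
    simp only [hA, hU, if_true]
    exact measure_iUnion hd fun n => (hA n).measurableSet
  invariant g s hs := by
    rw [if_pos hs, if_pos (hs.smul g), hμ g s hs.measurableSet]
  inner_regular s hs := by
    rw [if_pos hs]
    refine le_antisymm ?_ (iSup₂_le fun F hF => ?_)
    · obtain ⟨F, hF, hmono, rfl⟩ := hs.exists_iUnion_isClosed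
      rw [hmono.measure_iUnion]
      refine iSup_le fun n => ?_
      refine le_iSup₂_of_le (F n) ⟨(hF n).isCompact, subset_iUnion F n⟩ ?_
      rw [if_pos (hF n).inAlg]
    · rw [if_pos hF.1.isClosed.inAlg]
      exact measure_mono hF.2
  outer_regular s hs := by
    rw [if_pos hs, s.measure_eq_iInf_isOpen μ]
    refine le_antisymm (le_iInf₂ fun O hO => ?_) (le_iInf₂ fun O hsO => le_iInf fun hO => ?_)
    · rw [if_pos hO.1.inAlg]
      exact iInf₂_le_of_le O hO.2 (iInf_le _ hO.1)
    · exact iInf₂_le_of_le O ⟨hO, hsO⟩ (by rw [if_pos hO.inAlg])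

theorem SetSubeq.sum_measure_le [TopologicalSpace.MetrizableSpace X] [MeasurableSpace X]
    [BorelSpace X] [ContinuousConstSMul G X] (ν : Measure X)
    (hν : ∀ (g : G) (s : Set X), IsOpen s → ν (g • s) = ν s) {A B : List (Set X)}
    (hA : ∀ s ∈ A, IsOpen s) (h : SetSubeq G A B) : (A.map ν).sum ≤ (B.map ν).sum := by
  have hsum : ∀ L : List (Set X), (L.map ν).sum = ∑ i : Fin L.length, ν (L.get i) := by
    intro L
    simp [Fin.sum_univ_fun_getElem]
  choose K hK hmono hKA using fun i : Fin A.length =>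
    (hA (A.get i) (List.get_mem A i)).inAlg.exists_iUnion_isClosed
  rw [hsum A, hsum B]
  simp_rw [← hKA, (hmono _).measure_iUnion]
  rw [ENNReal.finsetSum_iSup_of_monotone fun i _ _ hmn => measure_mono (hmono i hmn)]
  refine iSup_le fun n => ?_
  obtain ⟨J, U, s, k, hU, hcov, hsub, hdisj⟩ := h (fun i => K i n)
    fun i => ⟨hK i n, (subset_iUnion (K i) n).trans (hKA i).subset⟩
  classical
  calc ∑ i, ν (K i n) ≤ ∑ i, ∑ j, ν (U i j) := by
        gcongr with i
        exact (measure_mono (hcov i)).trans (measure_iUnion_fintype_le _ _)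
    _ = ∑ p : Σ i : Fin A.length, Fin (J i), ν (s p.1 p.2 • U p.1 p.2) := by
        rw [Fintype.sum_sigma]
        simp_rw [hν _ _ (hU _ _)]
    _ = ∑ l : Fin B.length, ∑ p : Σ i : Fin A.length, Fin (J i) with k p.1 p.2 = l,
          ν (s p.1 p.2 • U p.1 p.2) := (Finset.sum_fiberwise _ _ _).symm
    _ ≤ ∑ l : Fin B.length, ν (B.get l) := by
        gcongr with l
        rw [← measure_biUnion_finset]
        · refine measure_mono (iUnion₂_subset fun p hp => ?_)
          rw [← (Finset.mem_filter.1 hp).2]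
          exact hsub _ _
        · intro p hp q hq hpq
          refine hdisj p q hpq ?_
          rw [(Finset.mem_filter.1 hp).2, (Finset.mem_filter.1 hq).2]
        · exact fun p _ => ((hU _ _).smul _).measurableSet

/-- The state `[(f₁, …, fₙ)] ↦ ∑ ν (supp fᵢ)` associated with an invariant Borel measure. -/
noncomputable def stateOfMeasure [TopologicalSpace.MetrizableSpace X] [MeasurableSpace X]
    [BorelSpace X] [ContinuousConstSMul G X] (ν : Measure X)
    (hν : ∀ (g : G) (s : Set X), IsOpen s → ν (g • s) = ν s) : DynState X G where
  toFun a := ((a.map osupp).map ν).sum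
  mono a b h := SetSubeq.sum_measure_le ν hν
    (by simpa using fun f _ => isOpen_osupp f) h
  additive a b := by simp
  zero' := by simp

theorem stateOfMeasure_lsc [TopologicalSpace.MetrizableSpace X] [MeasurableSpace X]
    [BorelSpace X] [ContinuousConstSMul G X] (ν : Measure X)
    (hν : ∀ (g : G) (s : Set X), IsOpen s → ν (g • s) = ν s) : (stateOfMeasure ν hν).LSC := by
  have hanti : ∀ a : List C(X, ℝ≥0),
      Antitone fun ε => (stateOfMeasure ν hν).toFun (cutList a ε) := by
    intro a ε δ h
    simp only [stateOfMeasure, cutList, List.map_map]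
    exact List.sum_le_sum fun f _ => measure_mono (osupp_cutFun_anti f h)
  have hseq : Antitone fun n : ℕ => 1 / ((n : ℝ≥0) + 1) := fun m n h => by
    dsimp only
    gcongr
  have hsup : ∀ a : List C(X, ℝ≥0), (stateOfMeasure ν hν).toFun a =
      ⨆ n : ℕ, (stateOfMeasure ν hν).toFun (cutList a (1 / ((n : ℝ≥0) + 1))) := by
    intro a
    induction a with
    | nil => simp [stateOfMeasure, cutList]
    | cons f a ih =>
      have hcons : ∀ (g : C(X, ℝ≥0)) b, (stateOfMeasure ν hν).toFun (g :: b) =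
          ν (osupp g) + (stateOfMeasure ν hν).toFun b := fun g b => by simp [stateOfMeasure]
      have hcut : ∀ ε, cutList (f :: a) ε = cutFun f ε :: cutList a ε := fun ε => rfl
      have hf : Monotone fun n : ℕ => osupp (cutFun f (1 / ((n : ℝ≥0) + 1))) :=
        (osupp_cutFun_anti f).comp hseq
      simp_rw [hcut, hcons]
      rw [ih, ← iUnion_osupp_cutFun f, hf.measure_iUnion]
      exact ENNReal.iSup_add_iSup_of_monotone (fun m n h => measure_mono (hf h))
        ((hanti a).comp hseq)
  intro a
  refine le_antisymm ?_ (iSup₂_le fun ε _ => ?_)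
  · rw [hsup a]
    exact iSup_le fun n => le_iSup₂_of_le (1 / ((n : ℝ≥0) + 1)) (by positivity) le_rfl
  · simp only [stateOfMeasure, cutList, List.map_map]
    refine List.sum_le_sum fun f _ => measure_mono ?_
    simp only [osupp_cutFun]
    exact fun x hx => (lt_of_le_of_lt zero_le hx).ne'

/-! ### From premeasures to measures -/

theorem InvRegPremeasure.exists_measure_eq [MeasurableSpace X] [BorelSpace X]
    (P : InvRegPremeasure X G) : ∃ ν : Measure X, ∀ s, InAlg X s → ν s = P.m s := by
  have hC : IsSetRing (generateSetAlgebra {t : Set X | IsOpen t}) :=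
    isSetAlgebra_generateSetAlgebra.isSetRing
  have hadd : ∀ {s t : Set X}, s ∈ generateSetAlgebra {t : Set X | IsOpen t} →
      t ∈ generateSetAlgebra {t : Set X | IsOpen t} → Disjoint s t →
      P.m (s ∪ t) = P.m s + P.m t := by
    intro s t hs ht hst
    let A : ℕ → Set X := fun n => if n = 0 then s else if n = 1 then t else ∅
    have hA : ∀ n, InAlg X (A n) := by
      intro n
      dsimp only [A]
      split_ifs
      exacts [hs, ht, generateSetAlgebra.empty]
    have hU : ⋃ n, A n = s ∪ t := by
      refine subset_antisymm (iUnion_subset fun n => ?_) (union_subset ?_ ?_)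
      · dsimp only [A]
        split_ifs <;> simp
      · exact subset_iUnion A 0
      · exact subset_iUnion A 1
    have hd : Pairwise (Function.onFun Disjoint A) := by
      intro i j hij
      dsimp only [Function.onFun, A]
      split_ifs <;> first | omega | simp [hst.symm]
    have h := P.countably_additive A hA hd (by rw [hU]; exact hC.union_mem hs ht)
    rw [hU, tsum_eq_sum (s := {0, 1}) fun n hn => ?_] at h
    · simpa [A] using h
    · simp only [Finset.mem_insert, Finset.mem_singleton, not_or] at hn
      simp [A, hn, P.empty']
  let c : AddContent ℝ≥0∞ (generateSetAlgebra {t : Set X | IsOpen t}) :=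
    hC.addContent_of_union P.m P.empty' hadd
  have hgen : ‹MeasurableSpace X› =
      MeasurableSpace.generateFrom (generateSetAlgebra {t : Set X | IsOpen t}) := by
    rw [generateFrom_generateSetAlgebra_eq, BorelSpace.measurable_eq (α := X)]
    rfl
  have hsub : c.IsSigmaSubadditive := isSigmaSubadditive_of_addContent_iUnion_eq_tsum hC
    fun f hf hU hd => P.countably_additive f hf hd hU
  exact ⟨c.measure hC.isSetSemiring hgen.le hsub,
    fun s hs => c.measure_eq hC.isSetSemiring hgen hsub hs⟩

theorem InvRegPremeasure.ext_of_isOpen {P Q : InvRegPremeasure X G}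
    (h : ∀ O, IsOpen O → P.m O = Q.m O) : P = Q := by
  have hm : P.m = Q.m := by
    ext s
    by_cases hs : InAlg X s
    · rw [P.outer_regular s hs, Q.outer_regular s hs]
      exact iInf_congr fun O => iInf_congr fun hO => h O hO.1
    · rw [P.junk s hs, Q.junk s hs]
  cases P
  cases Q
  congr

/-! ### From states to measures -/

namespace DynState

variable (D : DynState X G)

theorem ext_of_singleton {D E : DynState X G} (h : ∀ f, D.toFun [f] = E.toFun [f]) : D = E := by
  have hf : D.toFun = E.toFun := by
    ext a
    induction a with
    | nil => rw [D.zero', E.zero']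
    | cons f a ih => rw [← List.singleton_append, D.additive, E.additive, ih, h]
  cases D
  cases E
  congr

theorem toFun_le_sum_of_cover {ι : Type*} (t : Finset ι) (f : C(X, ℝ≥0)) (g : ι → C(X, ℝ≥0))
    (h : osupp f ⊆ ⋃ i ∈ t, osupp (g i)) : D.toFun [f] ≤ ∑ i ∈ t, D.toFun [g i] := by
  have hsum : ∀ l : List ι, D.toFun (l.map g) = (l.map fun i => D.toFun [g i]).sum := by
    intro l
    induction l with
    | nil => simp [D.zero']
    | cons i l ih =>
      rw [List.map_cons, ← List.singleton_append, D.additive, ih, List.map_cons, List.sum_cons]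
  rw [← Finset.sum_map_toList, ← hsum]
  refine D.mono _ _ fun F hF => ?_
  refine ⟨fun _ => ((t.toList.map g).map osupp).length,
    fun _ j => ((t.toList.map g).map osupp).get j, fun _ _ => 1, fun _ j => j, ?_, ?_, ?_, ?_⟩
  · intro _ j
    obtain ⟨f, -, hf⟩ := List.mem_map.1 (List.get_mem ((t.toList.map g).map osupp) j)
    exact hf.subst (isOpen_osupp f)
  · intro i x hx
    have hx' : x ∈ osupp f := by
      have := (hF i).2 hx
      obtain rfl : i = ⟨0, by simp⟩ := by
        apply Fin.ext
        simp
      exact this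
    obtain ⟨i, hi, hxi⟩ := mem_iUnion₂.1 (h hx')
    obtain ⟨j, hj⟩ := List.mem_iff_get.1
      (List.mem_map_of_mem (f := osupp) (List.mem_map_of_mem (f := g) (Finset.mem_toList.2 hi)))
    exact mem_iUnion.2 ⟨j, hj.symm.subset hxi⟩
  · intro _ j
    rw [one_smul]
  · rintro ⟨i, j⟩ ⟨i', j'⟩ hne hk
    have : i = i' := by
      apply Fin.ext
      have h1 := i.2
      have h2 := i'.2
      simp only [List.map_cons, List.map_nil, List.length_singleton] at h1 h2
      omega
    exact absurd (by subst this; exact congrArg _ hk) hne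

theorem toFun_le_of_osupp_subset {f g : C(X, ℝ≥0)} (h : osupp f ⊆ osupp g) :
    D.toFun [f] ≤ D.toFun [g] := by
  simpa using D.toFun_le_sum_of_cover {()} f (fun _ => g) (by simpa [iUnion_const] using h)

theorem toFun_eq_zero_of_osupp_eq_empty {f : C(X, ℝ≥0)} (h : osupp f = ∅) :
    D.toFun [f] = 0 := by
  simpa using D.toFun_le_sum_of_cover (∅ : Finset Unit) f (fun _ => f) (by simp [h])

theorem add_le_of_disjoint {f g h : C(X, ℝ≥0)} (hf : osupp f ⊆ osupp h)
    (hg : osupp g ⊆ osupp h) (hd : Disjoint (osupp f) (osupp g)) :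
    D.toFun [f] + D.toFun [g] ≤ D.toFun [h] := by
  rw [← D.additive]
  refine D.mono _ _ fun F hF => ?_
  refine ⟨fun _ => 1, fun i _ => (([f] ++ [g]).map osupp).get i, fun _ _ => 1,
    fun _ _ => ⟨0, by simp⟩, ?_, ?_, ?_, ?_⟩
  · intro i _
    obtain ⟨f, -, hf⟩ := List.mem_map.1 (List.get_mem (([f] ++ [g]).map osupp) i)
    exact hf.subst (isOpen_osupp f)
  · intro i
    exact (hF i).2.trans (subset_iUnion (fun _ : Fin 1 => _) 0)
  · intro i _
    rw [one_smul]
    change Fin 2 at i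
    fin_cases i
    exacts [hf, hg]
  · rintro ⟨i, j⟩ ⟨i', j'⟩ hne -
    simp only [one_smul]
    change Fin 2 at i i'
    change Fin 1 at j j'
    obtain rfl := Subsingleton.elim j j'
    fin_cases i <;> fin_cases i'
    exacts [absurd rfl hne, hd, hd.symm, absurd rfl hne]

theorem toFun_le_of_smul_osupp_eq [ContinuousConstSMul G X] (s : G) {f g : C(X, ℝ≥0)}
    (h : s • osupp f = osupp g) : D.toFun [f] ≤ D.toFun [g] := by
  refine D.mono _ _ fun F hF => ?_
  refine ⟨fun _ => 1, fun _ _ => osupp f, fun _ _ => s, fun _ _ => ⟨0, by simp⟩,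
    fun _ _ => isOpen_osupp f, ?_, fun _ _ => h.subset, ?_⟩
  · intro i
    change Fin 1 at i
    fin_cases i
    exact (hF _).2.trans (subset_iUnion (fun _ : Fin 1 => osupp f) 0)
  · rintro ⟨i, j⟩ ⟨i', j'⟩ hne -
    change Fin 1 at i i' j j'
    exact absurd (by rw [Subsingleton.elim i i', Subsingleton.elim j j']) hne

/-- The value of a state on an open set, extended monotonically to all sets. -/
noncomputable def onSet (s : Set X) : ℝ≥0∞ :=
  ⨆ (f : C(X, ℝ≥0)) (_ : osupp f ⊆ s), D.toFun [f]

theorem onSet_osupp (f : C(X, ℝ≥0)) : D.onSet (osupp f) = D.toFun [f] :=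
  le_antisymm (iSup₂_le fun _ hg => D.toFun_le_of_osupp_subset hg)
    (le_iSup₂_of_le f subset_rfl le_rfl)

theorem onSet_mono {s t : Set X} (h : s ⊆ t) : D.onSet s ≤ D.onSet t :=
  iSup₂_le fun f hf => le_iSup₂_of_le f (hf.trans h) le_rfl

theorem onSet_empty : D.onSet ∅ = 0 := by
  refine le_antisymm (iSup₂_le fun f hf => ?_) zero_le
  rw [D.toFun_eq_zero_of_osupp_eq_empty (subset_empty_iff.1 hf)]

variable [TopologicalSpace.MetrizableSpace X]

theorem onSet_smul [ContinuousConstSMul G X] (g : G) {O : Set X} (hO : IsOpen O) :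
    D.onSet (g • O) = D.onSet O := by
  obtain ⟨f, rfl⟩ := exists_osupp_eq hO
  obtain ⟨f', hf'⟩ := exists_osupp_eq (hO.smul g)
  rw [← hf', onSet_osupp, onSet_osupp]
  refine le_antisymm (D.toFun_le_of_smul_osupp_eq g⁻¹ ?_) (D.toFun_le_of_smul_osupp_eq g hf'.symm)
  rw [hf', inv_smul_smul]

theorem onSet_iUnion_le [CompactSpace X] (hD : D.LSC) (O : ℕ → Set X)
    (hO : ∀ n, IsOpen (O n)) : D.onSet (⋃ n, O n) ≤ ∑' n, D.onSet (O n) := by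
  choose g hg using fun n => exists_osupp_eq (hO n)
  refine iSup₂_le fun f hf => ?_
  rw [hD [f]]
  refine iSup₂_le fun ε hε => ?_
  have hK : IsCompact {x | ε ≤ f x} := (isClosed_le continuous_const f.continuous).isCompact
  obtain ⟨t, ht⟩ := hK.elim_finite_subcover O hO
    (subset_trans (fun x hx => (lt_of_lt_of_le hε hx).ne') hf)
  calc D.toFun [cutFun f ε] ≤ ∑ n ∈ t, D.toFun [g n] := by
        refine D.toFun_le_sum_of_cover t _ g ?_
        simp only [hg, osupp_cutFun]
        exact subset_trans (fun x (hx : ε < f x) => hx.le) ht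
    _ = ∑ n ∈ t, D.onSet (O n) := by simp only [← hg, onSet_osupp]
    _ ≤ ∑' n, D.onSet (O n) := ENNReal.sum_le_tsum t

/-- The outer measure induced by the values of a state on open sets. -/
noncomputable def outerMeasure : OuterMeasure X :=
  inducedOuterMeasure (fun (O : Set X) (_ : IsOpen O) => D.onSet O) isOpen_empty D.onSet_empty

variable [CompactSpace X] {D}

theorem outerMeasure_eq_iInf (hD : D.LSC) (s : Set X) :
    D.outerMeasure s = ⨅ (O : Set X) (_ : IsOpen O) (_ : s ⊆ O), D.onSet O :=
  inducedOuterMeasure_eq_iInf (fun _ h => isOpen_iUnion h) (fun f h => D.onSet_iUnion_le hD f h)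
    (fun _ _ _ _ h => D.onSet_mono h) s

theorem outerMeasure_of_isOpen (hD : D.LSC) {O : Set X} (hO : IsOpen O) :
    D.outerMeasure O = D.onSet O :=
  inducedOuterMeasure_eq' (fun _ h => isOpen_iUnion h) (fun f h => D.onSet_iUnion_le hD f h)
    (fun _ _ _ _ h => D.onSet_mono h) hO

theorem outerMeasure_smul [ContinuousConstSMul G X] (hD : D.LSC) (g : G) (s : Set X) :
    D.outerMeasure (g • s) = D.outerMeasure s := by
  have hle : ∀ (g : G) (s : Set X), D.outerMeasure (g • s) ≤ D.outerMeasure s := by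
    intro g s
    rw [outerMeasure_eq_iInf hD s]
    refine le_iInf₂ fun O hO => le_iInf fun hsO => ?_
    rw [← D.onSet_smul g hO, ← outerMeasure_of_isOpen hD (hO.smul g)]
    exact measure_mono (smul_set_mono hsO)
  refine le_antisymm (hle g s) ?_
  simpa using hle g⁻¹ (g • s)

theorem le_caratheodory_outerMeasure [MeasurableSpace X] [BorelSpace X] (hD : D.LSC) :
    ‹MeasurableSpace X› ≤ D.outerMeasure.caratheodory := by
  let := TopologicalSpace.metrizableSpaceMetric X
  refine OuterMeasure.IsMetric.le_caratheodory fun s t hst => ?_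
  refine le_antisymm (measure_union_le s t) ?_
  obtain ⟨r, hr, hst⟩ := hst
  have hr2 : 0 < r / 2 := ENNReal.half_pos hr
  rw [outerMeasure_eq_iInf hD (s ∪ t)]
  refine le_iInf₂ fun O hO => le_iInf fun hsub => ?_
  obtain ⟨U, V, hU, hV, hsU, htV, hUV⟩ : ∃ U V : Set X, IsOpen U ∧ IsOpen V ∧
      s ⊆ U ∧ t ⊆ V ∧ Disjoint U V := by
    refine ⟨⋃ x ∈ s, Metric.eball x (r / 2), ⋃ y ∈ t, Metric.eball y (r / 2),
      isOpen_biUnion fun _ _ => Metric.isOpen_eball, isOpen_biUnion fun _ _ => Metric.isOpen_eball,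
      fun x hx => mem_biUnion hx (Metric.mem_eball_self hr2),
      fun x hx => mem_biUnion hx (Metric.mem_eball_self hr2), ?_⟩
    simp only [disjoint_iUnion_left, disjoint_iUnion_right]
    intro y hy x hx
    refine Metric.eball_disjoint ?_
    rw [ENNReal.add_halves]
    exact hst x hx y hy
  obtain ⟨f, hf⟩ := exists_osupp_eq hO
  obtain ⟨f₁, hf₁⟩ := exists_osupp_eq (hO.inter hU)
  obtain ⟨f₂, hf₂⟩ := exists_osupp_eq (hO.inter hV)
  calc D.outerMeasure s + D.outerMeasure t
      ≤ D.outerMeasure (O ∩ U) + D.outerMeasure (O ∩ V) := by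
        gcongr
        exacts [subset_inter (subset_union_left.trans hsub) hsU,
          subset_inter (subset_union_right.trans hsub) htV]
    _ = D.toFun [f₁] + D.toFun [f₂] := by
        rw [outerMeasure_of_isOpen hD (hO.inter hU), outerMeasure_of_isOpen hD (hO.inter hV),
          ← hf₁, ← hf₂, onSet_osupp, onSet_osupp]
    _ ≤ D.toFun [f] := by
        refine D.add_le_of_disjoint ?_ ?_ ?_
        · rw [hf, hf₁]
          exact inter_subset_left
        · rw [hf, hf₂]
          exact inter_subset_left
        · rw [hf₁, hf₂]
          exact hUV.mono inter_subset_right inter_subset_right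
    _ = D.onSet O := by rw [← hf, onSet_osupp]

variable [MeasurableSpace X] [BorelSpace X]

/-- The Borel measure induced by a lower semicontinuous state. -/
noncomputable def measure (hD : D.LSC) : Measure X :=
  D.outerMeasure.toMeasure (le_caratheodory_outerMeasure hD)

theorem measure_of_measurableSet (hD : D.LSC) {s : Set X} (hs : MeasurableSet s) :
    measure hD s = D.outerMeasure s :=
  toMeasure_apply _ _ hs

theorem measure_osupp (hD : D.LSC) (f : C(X, ℝ≥0)) : measure hD (osupp f) = D.toFun [f] := by
  rw [measure_of_measurableSet hD (isOpen_osupp f).measurableSet,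
    outerMeasure_of_isOpen hD (isOpen_osupp f), onSet_osupp]

theorem measure_smul [ContinuousConstSMul G X] (hD : D.LSC) (g : G) {s : Set X}
    (hs : MeasurableSet s) : measure hD (g • s) = measure hD s := by
  rw [measure_of_measurableSet hD hs, measure_of_measurableSet hD (hs.const_smul g),
    outerMeasure_smul hD]

theorem outerRegular_measure (hD : D.LSC) : (measure hD).OuterRegular := by
  refine ⟨fun A hA r hr => ?_⟩
  rw [measure_of_measurableSet hD hA, outerMeasure_eq_iInf hD] at hr
  simp only [gt_iff_lt, iInf_lt_iff] at hr
  obtain ⟨O, hO, hAO, hr⟩ := hr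
  refine ⟨O, hAO, hO, ?_⟩
  rwa [measure_of_measurableSet hD hO.measurableSet, outerMeasure_of_isOpen hD hO]

end DynState

theorem iInf_isOpen_add_mul (α β : Set X → ℝ≥0∞) (hα : Monotone α) (hβ : Monotone β)
    {t u : ℝ≥0∞} (ht : t ≠ ∞) (hu : u ≠ ∞) (s : Set X) :
    ⨅ (O : Set X) (_ : IsOpen O ∧ s ⊆ O), (t * α O + u * β O) =
      t * (⨅ (O : Set X) (_ : IsOpen O ∧ s ⊆ O), α O) +
        u * ⨅ (O : Set X) (_ : IsOpen O ∧ s ⊆ O), β O := by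
  have : Nonempty {O : Set X // IsOpen O ∧ s ⊆ O} := ⟨⟨univ, isOpen_univ, subset_univ s⟩⟩
  simp only [iInf_subtype']
  rw [ENNReal.mul_iInf fun h => absurd h ht, ENNReal.mul_iInf fun h => absurd h hu,
    ENNReal.iInf_add_iInf]
  intro O O'
  refine ⟨⟨O ∩ O', O.2.1.inter O'.2.1, subset_inter O.2.2 O'.2.2⟩, ?_⟩
  gcongr
  exacts [hα inter_subset_left, hβ inter_subset_right]

end Auxiliary

open MeasureTheory in
/-- **Theorem 3.7.** The map `D ↦ μ_D` is an affine bijection from the set of lower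
semi-continuous states on `W(X, G)` onto the set of `G`-invariant regular premeasures on
the algebra generated by the open sets; in particular it restricts to an affine bijection
between the lower semi-continuous states with `D([1_X]) = 1` and the `G`-invariant regular
Borel probability measures `M_G(X)`. -/
theorem lscStates_biject_premeasures {X : Type*} [TopologicalSpace X] [CompactSpace X]
    [T2Space X] [TopologicalSpace.MetrizableSpace X] [MeasurableSpace X] [BorelSpace X]
    {G : Type*} [Group G] [MulAction G X]
    (hG : ∀ g : G, Continuous fun x : X => g • x) :
    ∃ Φ : {D : DynState X G // D.LSC} → InvRegPremeasure X G,
      Function.Bijective Φ ∧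
      (∀ (D : {D : DynState X G // D.LSC}) (f : C(X, ℝ≥0)),
        (Φ D).m (osupp f) = D.1.toFun [f]) ∧
      -- affineness
      (∀ (D₁ D₂ E : {D : DynState X G // D.LSC}) (t : ℝ≥0∞), t ≤ 1 →
        (∀ a, E.1.toFun a = t * D₁.1.toFun a + (1 - t) * D₂.1.toFun a) →
        ∀ s : Set X, InAlg X s → (Φ E).m s = t * (Φ D₁).m s + (1 - t) * (Φ D₂).m s) ∧
      -- the restriction to normalized lower semi-continuous states
      ∃ Ψ : {D : DynState X G // D.LSC ∧ D.toFun [(1 : C(X, ℝ≥0))] = 1} →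
            {μ : Measure X // IsProbabilityMeasure μ ∧ μ.Regular ∧
              ∀ (g : G) (s : Set X), MeasurableSet s → μ (g • s) = μ s},
        Function.Bijective Ψ ∧
        ∀ (D : {D : DynState X G // D.LSC ∧ D.toFun [(1 : C(X, ℝ≥0))] = 1})
          (f : C(X, ℝ≥0)), (Ψ D).1 (osupp f) = D.1.toFun [f] := by
  have : ContinuousConstSMul G X := ⟨hG⟩
  have hreg : ∀ D : {D : DynState X G // D.LSC}, (DynState.measure D.2).OuterRegular :=
    fun D => DynState.outerRegular_measure D.2
  have hinv : ∀ (D : {D : DynState X G // D.LSC}) (g : G) (s : Set X), MeasurableSet s →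
      DynState.measure D.2 (g • s) = DynState.measure D.2 s :=
    fun D g s hs => DynState.measure_smul D.2 g hs
  let Φ : {D : DynState X G // D.LSC} → InvRegPremeasure X G :=
    fun D => premeasureOfMeasure (DynState.measure D.2) (hinv D)
  have hΦ : ∀ D s, InAlg X s → (Φ D).m s = DynState.measure D.2 s := fun D s hs => if_pos hs
  have hΦf : ∀ (D : {D : DynState X G // D.LSC}) (f : C(X, ℝ≥0)),
      (Φ D).m (osupp f) = D.1.toFun [f] := fun D f => by
    rw [hΦ D _ (isOpen_osupp f).inAlg, DynState.measure_osupp]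
  refine ⟨Φ, ⟨?_, ?_⟩, hΦf, ?_, ?_⟩
  · intro D E h
    refine Subtype.ext (DynState.ext_of_singleton fun f => ?_)
    rw [← hΦf, ← hΦf, h]
  · intro P
    obtain ⟨ν, hν⟩ := P.exists_measure_eq
    have hνinv : ∀ (g : G) (s : Set X), IsOpen s → ν (g • s) = ν s := fun g s hs => by
      rw [hν s hs.inAlg, hν _ (hs.smul g).inAlg, P.invariant g s hs.inAlg]
    refine ⟨⟨stateOfMeasure ν hνinv, stateOfMeasure_lsc ν hνinv⟩,
      InvRegPremeasure.ext_of_isOpen fun O hO => ?_⟩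
    obtain ⟨f, rfl⟩ := exists_osupp_eq hO
    rw [hΦf, ← hν _ hO.inAlg]
    simp [stateOfMeasure]
  · intro D₁ D₂ E t ht h s hs
    have hmono : ∀ D : {D : DynState X G // D.LSC}, Monotone (DynState.measure D.2) :=
      fun D A B hAB => measure_mono hAB
    rw [(Φ E).outer_regular s hs, (Φ D₁).outer_regular s hs, (Φ D₂).outer_regular s hs]
    have hopen : ∀ (D : {D : DynState X G // D.LSC}),
        ⨅ (O : Set X) (_ : IsOpen O ∧ s ⊆ O), (Φ D).m O =
          ⨅ (O : Set X) (_ : IsOpen O ∧ s ⊆ O), DynState.measure D.2 O := fun D =>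
      iInf_congr fun O => iInf_congr fun hO => hΦ D O hO.1.inAlg
    rw [hopen D₁, hopen D₂, ← iInf_isOpen_add_mul _ _ (hmono D₁) (hmono D₂)
      (ne_top_of_le_ne_top ENNReal.one_ne_top ht) (ENNReal.sub_ne_top ENNReal.one_ne_top)]
    refine iInf_congr fun O => iInf_congr fun hO => ?_
    obtain ⟨f, rfl⟩ := exists_osupp_eq hO.1
    rw [hΦf, h, DynState.measure_osupp, DynState.measure_osupp]
  · have hone : osupp (1 : C(X, ℝ≥0)) = Set.univ := by
      ext x
      simp [osupp]
    have hprob : ∀ D : {D : DynState X G // D.LSC ∧ D.toFun [(1 : C(X, ℝ≥0))] = 1},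
        IsProbabilityMeasure (DynState.measure D.2.1) := fun D =>
      ⟨by rw [← hone, DynState.measure_osupp, D.2.2]⟩
    refine ⟨fun D => ⟨DynState.measure D.2.1, hprob D, ?_, hinv ⟨D.1, D.2.1⟩⟩, ⟨?_, ?_⟩,
      fun D f => DynState.measure_osupp D.2.1 f⟩
    · have := hprob D
      infer_instance
    · intro D E h
      refine Subtype.ext (DynState.ext_of_singleton fun f => ?_)
      rw [← DynState.measure_osupp D.2.1, ← DynState.measure_osupp E.2.1]
      exact congrArg (fun μ => μ.1 (osupp f)) h
    · rintro ⟨μ, hμ, hμreg, hμinv⟩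
      have hμo : ∀ (g : G) (s : Set X), IsOpen s → μ (g • s) = μ s :=
        fun g s hs => hμinv g s hs.measurableSet
      have hval : ∀ f, (stateOfMeasure μ hμo).toFun [f] = μ (osupp f) := fun f => by
        simp [stateOfMeasure]
      refine ⟨⟨stateOfMeasure μ hμo, stateOfMeasure_lsc μ hμo, ?_⟩, Subtype.ext ?_⟩
      · rw [hval, hone, measure_univ]
      · have := hreg ⟨stateOfMeasure μ hμo, stateOfMeasure_lsc μ hμo⟩
        refine Measure.OuterRegular.ext_isOpen fun O hO => ?_
        obtain ⟨f, rfl⟩ := exists_osupp_eq hO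
        rw [DynState.measure_osupp, hval]
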